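/- arXiv:0710.1909 — 5 statements merged into one kernel-verified Lean document; each statement's English description precedes it below -/
import Mathlib

section
/- Let (Ω, F, P) be a probability space, G ⊆ F a sub-σ-algebra, and ζ : Ω → [0,∞) an integrable nonnegative random variable. Let ξ be (a version of) the conditional expectation E[ζ | G]. Then ξ dominates ζ stochastically in the second order, i.e. for every t ≥ 0 one has ∫₀ᵗ P[ξ ≥ u] du ≥ ∫₀ᵗ P[ζ ≥ u] du. -/
open MeasureTheory

lemma layercake_min_aux {Ω : Type*} {F : MeasurableSpace Ω} (P : Measure Ω)
    [IsProbabilityMeasure P] (f : Ω → ℝ) (hf0 : 0 ≤ᵐ[P] f) (hf : Integrable f P)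
    (t : ℝ) (ht : 0 ≤ t) :
    ∫ u in (0:ℝ)..t, (P {ω | u ≤ f ω}).toReal = ∫ ω, min (f ω) t ∂P := by
  have hint : Integrable (fun ω => min (f ω) t) P := hf.inf (integrable_const t)
  rw [hint.integral_eq_integral_Ioc_meas_le (M := t), intervalIntegral.integral_of_le ht]
  · apply setIntegral_congr_fun measurableSet_Ioc
    intro u hu
    simp only [Measure.real, le_min_iff, hu.2, and_true]
  · filter_upwards [hf0] with ω h using le_min h ht
  · exact Filter.Eventually.of_forall fun ω => min_le_right _ _

/-- Second-order stochastic dominance of the conditional expectation: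
if `ξ` is a version of `E[ζ | G]` for a nonnegative integrable `ζ`, then
`∫₀ᵗ P[ξ ≥ u] du ≥ ∫₀ᵗ P[ζ ≥ u] du` for every `t ≥ 0`. -/
theorem conditional_expectation_second_order_dominates
    {Ω : Type*} {F : MeasurableSpace Ω} (P : Measure Ω) [IsProbabilityMeasure P]
    (G : MeasurableSpace Ω) (hG : G ≤ F) (ζ ξ : Ω → ℝ)
    (hζ0 : ∀ ω, 0 ≤ ζ ω) (hζint : Integrable ζ P)
    (hξ : ξ =ᵐ[P] P[ζ|G]) :
    ∀ t : ℝ, 0 ≤ t →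
      ∫ u in (0:ℝ)..t, (P {ω | u ≤ ζ ω}).toReal ≤
        ∫ u in (0:ℝ)..t, (P {ω | u ≤ ξ ω}).toReal := by
  intro t ht
  have hξint : Integrable ξ P := integrable_condExp.congr hξ.symm
  have hξ0 : 0 ≤ᵐ[P] ξ := by
    filter_upwards [hξ, condExp_nonneg (m := G) (Filter.Eventually.of_forall hζ0 : 0 ≤ᵐ[P] ζ)]
      with ω h1 h2
    rw [h1]; exact h2
  rw [layercake_min_aux P ζ (Filter.Eventually.of_forall hζ0) hζint t ht,
    layercake_min_aux P ξ hξ0 hξint t ht]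
  have hint : Integrable (fun ω => min (ζ ω) t) P := hζint.inf (integrable_const t)
  rw [← integral_condExp hG (f := fun ω => min (ζ ω) t)]
  apply integral_mono_ae integrable_condExp (hξint.inf (integrable_const t))
  have h1 : P[fun ω => min (ζ ω) t|G] ≤ᵐ[P] P[ζ|G] :=
    condExp_mono hint hζint (Filter.Eventually.of_forall fun ω => min_le_left _ _)
  have h2 : P[fun ω => min (ζ ω) t|G] ≤ᵐ[P] P[fun _ => t|G] :=
    condExp_mono hint (integrable_const t) (Filter.Eventually.of_forall fun ω => min_le_right _ _)
  rw [condExp_const hG] at h2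
  filter_upwards [h1, h2, hξ] with ω a b c
  exact le_min (c ▸ a) b
end

section
/- Let I₁, I₂ : (0,∞) → (0,∞) be differentiable, strictly decreasing bijections of (0,∞) onto itself, and let a : (0,∞) → ℝ be a function such that I₂(y·z) = a(y)·I₁(z) for all y, z > 0. Then, setting c := I₁'(1)/I₁(1), one has c < 0 and I₁(y) = I₁(1)·y^c and I₂(y) = I₂(1)·y^c for all y > 0. -/
/-- Functional-equation core of the Cass–Stiglitz argument: if `I₁, I₂` are
differentiable strictly decreasing bijections of `(0,∞)` onto itself and
`I₂(y·z) = a(y)·I₁(z)` for all `y, z > 0`, then with `c := I₁'(1)/I₁(1)` one has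
`c < 0` and `I₁(y) = I₁(1)·y^c`, `I₂(y) = I₂(1)·y^c` for all `y > 0`. -/
theorem power_form_of_multiplicative_functional_equation
    (I₁ I₂ a : ℝ → ℝ)
    (hI₁diff : ∀ x > (0:ℝ), DifferentiableAt ℝ I₁ x)
    (hI₂diff : ∀ x > (0:ℝ), DifferentiableAt ℝ I₂ x)
    (hI₁anti : StrictAntiOn I₁ (Set.Ioi 0))
    (hI₂anti : StrictAntiOn I₂ (Set.Ioi 0))
    (hI₁bij : Set.BijOn I₁ (Set.Ioi 0) (Set.Ioi 0))
    (hI₂bij : Set.BijOn I₂ (Set.Ioi 0) (Set.Ioi 0))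
    (hfe : ∀ y > (0:ℝ), ∀ z > (0:ℝ), I₂ (y * z) = a y * I₁ z) :
    deriv I₁ 1 / I₁ 1 < 0 ∧
      ∀ y > (0:ℝ),
        I₁ y = I₁ 1 * y ^ (deriv I₁ 1 / I₁ 1) ∧
        I₂ y = I₂ 1 * y ^ (deriv I₁ 1 / I₁ 1) := by
  have hp1 : 0 < I₁ 1 := hI₁bij.mapsTo (Set.mem_Ioi.2 one_pos)
  have hp2 : 0 < I₂ 1 := hI₂bij.mapsTo (Set.mem_Ioi.2 one_pos)
  set c := deriv I₁ 1 / I₁ 1 with hc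
  have hd1 : deriv I₁ 1 = c * I₁ 1 := by rw [hc]; field_simp
  have hode : ∀ y > (0:ℝ), deriv I₂ y * y = c * I₂ y := by
    intro y hy
    have h1 : HasDerivAt (fun z => I₂ (y * z)) (deriv I₂ y * y) 1 := by
      have h2 : HasDerivAt (fun z : ℝ => y * z) y 1 := by
        simpa using (hasDerivAt_id (1:ℝ)).const_mul y
      have h3 : HasDerivAt I₂ (deriv I₂ y) (y * 1) := by
        rw [mul_one]; exact (hI₂diff y hy).hasDerivAt
      exact HasDerivAt.comp (1:ℝ) h3 h2
    have h4 : HasDerivAt (fun z => I₂ (y * z)) (a y * deriv I₁ 1) 1 := by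
      refine ((hI₁diff 1 one_pos).hasDerivAt.const_mul (a y)).congr_of_eventuallyEq ?_
      filter_upwards [Ioi_mem_nhds (one_pos : (0:ℝ) < 1)] with z hz
      exact hfe y hy z hz
    have h5 := hfe y hy 1 one_pos
    rw [mul_one] at h5
    rw [h1.unique h4, h5, hd1]; ring
  have hG : ∀ y > (0:ℝ), HasDerivAt (fun x => I₂ x * x ^ (-c)) 0 y := by
    intro y hy
    have h := (hI₂diff y hy).hasDerivAt.mul
      (Real.hasDerivAt_rpow_const (p := -c) (Or.inl hy.ne'))
    refine HasDerivAt.congr_deriv (f := fun x => I₂ x * x ^ (-c)) h ?_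
    have h6 := hode y hy
    rw [Real.rpow_sub_one hy.ne']
    field_simp
    linear_combination y ^ (-c) * h6
  have hconst : ∀ y > (0:ℝ), I₂ y = I₂ 1 * y ^ c := by
    intro y hy
    have h := isOpen_Ioi.is_const_of_deriv_eq_zero (𝕜 := ℝ) (s := Set.Ioi (0:ℝ))
      (f := fun x => I₂ x * x ^ (-c)) isPreconnected_Ioi
      (fun x hx => (hG x hx).differentiableAt.differentiableWithinAt)
      (fun x hx => (hG x hx).deriv) (Set.mem_Ioi.2 hy) (Set.mem_Ioi.2 one_pos)
    simp only [Real.one_rpow, mul_one, Real.rpow_neg hy.le] at h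
    have := Real.rpow_pos_of_pos hy c
    rw [← h]; field_simp
  refine ⟨?_, fun y hy => ⟨?_, hconst y hy⟩⟩
  · by_contra! hcn
    have h := hI₂anti (Set.mem_Ioi.2 one_pos) (Set.mem_Ioi.2 two_pos) one_lt_two
    rw [hconst 2 two_pos] at h
    have := Real.one_le_rpow (one_le_two : (1:ℝ) ≤ 2) hcn
    nlinarith
  · have h1 := hfe 1 one_pos 1 one_pos
    have h2 := hfe 1 one_pos y hy
    rw [one_mul] at h1 h2
    have ha : a 1 ≠ 0 := by
      intro h0
      rw [h0, zero_mul] at h1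
      exact hp2.ne' h1
    apply mul_left_cancel₀ ha
    rw [← h2, hconst y hy, h1]; ring
end

section
/- Let U₁, U₂ : (0,∞) → ℝ be strictly increasing, strictly concave, twice differentiable functions whose derivatives U₁' and U₂' are strictly decreasing differentiable bijections of (0,∞) onto (0,∞), and assume the inverse function I₂ := (U₂')⁻¹ is differentiable. Suppose that for every y > 0 there exist real numbers a(y), b(y) such that I₂(y·U₁'(x)) = a(y)·x + b(y) for all x > 0. Then there exists β < 0 such that U₁'(x) = U₁'(1)·x^β and U₂'(x) = U₂'(1)·x^β for all x > 0. -/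
/-- Analytic conclusion of the Cass–Stiglitz-type theorem: if `U₁, U₂` are strictly
increasing, strictly concave, twice differentiable utilities on `(0,∞)` whose marginal
utilities are strictly decreasing differentiable bijections of `(0,∞)` onto itself with
`I₂ := (U₂')⁻¹` differentiable, and for every `y > 0` the map `x ↦ I₂(y·U₁'(x))` is
affine on `(0,∞)`, then both marginal utilities are power functions with the same
negative exponent. -/
theorem cass_stiglitz_marginal_utilities_power
    (U₁ U₂ I₂ : ℝ → ℝ)
    (hU₁inc : StrictMonoOn U₁ (Set.Ioi 0))
    (hU₂inc : StrictMonoOn U₂ (Set.Ioi 0))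
    (hU₁conc : StrictConcaveOn ℝ (Set.Ioi 0) U₁)
    (hU₂conc : StrictConcaveOn ℝ (Set.Ioi 0) U₂)
    (hU₁d : ∀ x > (0:ℝ), DifferentiableAt ℝ U₁ x)
    (hU₂d : ∀ x > (0:ℝ), DifferentiableAt ℝ U₂ x)
    (hU₁dd : ∀ x > (0:ℝ), DifferentiableAt ℝ (deriv U₁) x)
    (hU₂dd : ∀ x > (0:ℝ), DifferentiableAt ℝ (deriv U₂) x)
    (hU₁'anti : StrictAntiOn (deriv U₁) (Set.Ioi 0))
    (hU₂'anti : StrictAntiOn (deriv U₂) (Set.Ioi 0))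
    (hU₁'bij : Set.BijOn (deriv U₁) (Set.Ioi 0) (Set.Ioi 0))
    (hU₂'bij : Set.BijOn (deriv U₂) (Set.Ioi 0) (Set.Ioi 0))
    (hI₂left : ∀ x > (0:ℝ), I₂ (deriv U₂ x) = x)
    (hI₂right : ∀ y > (0:ℝ), deriv U₂ (I₂ y) = y)
    (hI₂diff : ∀ y > (0:ℝ), DifferentiableAt ℝ I₂ y)
    (haffine : ∀ y > (0:ℝ), ∃ a b : ℝ, ∀ x > (0:ℝ), I₂ (y * deriv U₁ x) = a * x + b) :
    ∃ β : ℝ, β < 0 ∧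
      ∀ x > (0:ℝ),
        deriv U₁ x = deriv U₁ 1 * x ^ β ∧
        deriv U₂ x = deriv U₂ 1 * x ^ β := by
  have fpos : ∀ x > (0:ℝ), 0 < deriv U₁ x := fun x hx => hU₁'bij.mapsTo hx
  have gpos : ∀ x > (0:ℝ), 0 < deriv U₂ x := fun x hx => hU₂'bij.mapsTo hx
  have hgc : ∀ x > (0:ℝ), ContinuousAt (deriv U₂) x := fun x hx => (hU₂dd x hx).continuousAt
  generalize deriv U₁ = f at *
  generalize deriv U₂ = g at *
  have Ipos : ∀ y > (0:ℝ), 0 < I₂ y := by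
    intro y hy
    obtain ⟨x, hx, rfl⟩ := hU₂'bij.surjOn hy
    rw [hI₂left x hx]
    exact hx
  have key : ∀ a > (0:ℝ), ∀ x > (0:ℝ), g (a * x) * f 1 = g a * f x := by
    intro a ha x hx
    have hf1 := fpos 1 one_pos
    have hy : 0 < g a / f 1 := div_pos (gpos a ha) hf1
    obtain ⟨A, B, hAB⟩ := haffine _ hy
    have hpos : ∀ x > (0:ℝ), 0 < A * x + B := by
      intro x hx
      rw [← hAB x hx]
      exact Ipos _ (mul_pos hy (fpos x hx))
    have hB : B = 0 := by
      rcases lt_trichotomy B 0 with h | h | h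
      · exfalso
        have h1 := hpos 1 one_pos
        have hA : 0 < A := by linarith
        have h2 := hpos (-B / (2 * A)) (div_pos (by linarith) (by linarith))
        have h3 : A * (-B / (2 * A)) = -B / 2 := by field_simp
        linarith
      · exact h
      · exfalso
        have hz : 0 < B / 2 := by linarith
        obtain ⟨x, hx, hfx⟩ := hU₁'bij.surjOn
          (show g (B / 2) / (g a / f 1) ∈ Set.Ioi 0 from div_pos (gpos _ hz) hy)
        have hx0 : 0 < x := hx
        have h1 := hAB x hx0
        rw [hfx, mul_div_cancel₀ _ hy.ne', hI₂left _ hz] at h1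
        have h2 := hpos (2 * x) (by linarith)
        linarith
    have h1 := hAB 1 one_pos
    rw [div_mul_cancel₀ _ hf1.ne', hI₂left a ha] at h1
    have hA : A = a := by linarith
    have h2 := hAB x hx
    rw [hA, hB, add_zero] at h2
    rw [← h2, hI₂right _ (mul_pos hy (fpos x hx))]
    field_simp
  have hf1 := fpos 1 one_pos
  have hg1 := gpos 1 one_pos
  have hfg : ∀ x > (0:ℝ), g x * f 1 = g 1 * f x := by
    intro x hx
    simpa using key 1 one_pos x hx
  have hmul : ∀ a > (0:ℝ), ∀ x > (0:ℝ), g (a * x) * g 1 = g a * g x := by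
    intro a ha x hx
    have h1 := key a ha x hx
    have h2 := hfg x hx
    have : f 1 * (g (a * x) * g 1) = f 1 * (g a * g x) := by
      linear_combination g 1 * h1 - g a * h2
    exact mul_left_cancel₀ hf1.ne' this
  let φ : ℝ →+ ℝ := AddMonoidHom.mk' (fun t => Real.log (g (Real.exp t)) - Real.log (g 1)) (by
    intro s t
    have h := hmul _ (Real.exp_pos s) _ (Real.exp_pos t)
    rw [← Real.exp_add] at h
    have h' := congrArg Real.log h
    rw [Real.log_mul (gpos _ (Real.exp_pos _)).ne' hg1.ne',
      Real.log_mul (gpos _ (Real.exp_pos _)).ne' (gpos _ (Real.exp_pos _)).ne'] at h'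
    linarith)
  have hφ : ∀ t, φ t = Real.log (g (Real.exp t)) - Real.log (g 1) := fun t => rfl
  have hφc : Continuous φ := by
    have : Continuous fun t => g (Real.exp t) := continuous_iff_continuousAt.2 fun t =>
      ContinuousAt.comp (f := Real.exp) (hgc _ (Real.exp_pos t)) Real.continuous_exp.continuousAt
    exact (this.log fun t => (gpos _ (Real.exp_pos t)).ne').sub continuous_const
  have hlin : ∀ t, φ t = t * φ 1 := by
    intro t
    have h := map_real_smul φ hφc t 1
    simpa using h
  have hg : ∀ x > (0:ℝ), g x = g 1 * x ^ (φ 1) := by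
    intro x hx
    have h := hlin (Real.log x)
    rw [hφ, Real.exp_log hx] at h
    rw [Real.rpow_def_of_pos hx, ← h, Real.exp_sub, Real.exp_log (gpos x hx), Real.exp_log hg1]
    field_simp
  refine ⟨φ 1, ?_, fun x hx => ⟨?_, hg x hx⟩⟩
  · rw [hφ, sub_neg]
    refine Real.log_lt_log (gpos _ (Real.exp_pos _)) ?_
    exact hU₂'anti (Set.mem_Ioi.2 one_pos) (Set.mem_Ioi.2 (Real.exp_pos 1))
      (Real.one_lt_exp_iff.2 one_pos)
  · have h := hfg x hx
    rw [hg x hx] at h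
    apply mul_left_cancel₀ hg1.ne'
    linear_combination -h
end

section
/- Let x > 0, p ∈ (0,1), and let a, b be real numbers with x − a > 0, x + a + b > 0 and x + a − b > 0. Then (1/2)·[p·log(x+a+b) + (1−p)·log(x+a−b)] + (1/2)·log(x−a) ≤ log x + (1/2)·[log 2 + p·log p + (1−p)·log(1−p)], with equality if and only if a = 0 and b = (2p−1)·x. -/
theorem log_tangent_le {y c : ℝ} (hy : 0 < y) (hc : 0 < c) :
    Real.log y ≤ Real.log c + (y / c - 1) := by
  have h := Real.log_le_sub_one_of_pos (div_pos hy hc)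
  rw [Real.log_div hy.ne' hc.ne'] at h
  linarith

theorem log_tangent_lt {y c : ℝ} (hy : 0 < y) (hc : 0 < c) (hne : y ≠ c) :
    Real.log y < Real.log c + (y / c - 1) := by
  have h := Real.log_lt_sub_one_of_pos (div_pos hy hc)
    (fun h => hne ((div_eq_one_iff_eq hc.ne').1 h))
  rw [Real.log_div hy.ne' hc.ne'] at h
  linarith

/-- Two-period log-utility computation of Example 4.4: the expected logarithmic utility
of a strategy holding `a` units in the first period and `b` units in the second period
(on the event `ε₁ = 1`) is at most `log x + (1/2)(log 2 + p log p + (1−p) log(1−p))`,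
with equality iff `a = 0` and `b = (2p−1)x`. -/
theorem two_period_log_optimality
    (x p a b : ℝ) (hx : 0 < x) (hp : p ∈ Set.Ioo (0:ℝ) 1)
    (h1 : 0 < x - a) (h2 : 0 < x + a + b) (h3 : 0 < x + a - b) :
    (1/2) * (p * Real.log (x + a + b) + (1 - p) * Real.log (x + a - b))
        + (1/2) * Real.log (x - a)
      ≤ Real.log x
        + (1/2) * (Real.log 2 + p * Real.log p + (1 - p) * Real.log (1 - p)) ∧
    ((1/2) * (p * Real.log (x + a + b) + (1 - p) * Real.log (x + a - b))
        + (1/2) * Real.log (x - a)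
      = Real.log x
        + (1/2) * (Real.log 2 + p * Real.log p + (1 - p) * Real.log (1 - p))
      ↔ a = 0 ∧ b = (2 * p - 1) * x) := by
  obtain ⟨hp0, hp1⟩ := hp
  have hq : 0 < 1 - p := by linarith
  have c1 : 0 < 2 * p * x := by positivity
  have c2 : 0 < 2 * (1 - p) * x := by positivity
  have l1 : Real.log (2 * p * x) = Real.log 2 + Real.log p + Real.log x := by
    rw [Real.log_mul (by positivity) hx.ne', Real.log_mul (by norm_num) hp0.ne']
  have l2 : Real.log (2 * (1 - p) * x) = Real.log 2 + Real.log (1 - p) + Real.log x := by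
    rw [Real.log_mul (by positivity) hx.ne', Real.log_mul (by norm_num) hq.ne']
  have key : p * ((x + a + b) / (2 * p * x) - 1)
      + (1 - p) * ((x + a - b) / (2 * (1 - p) * x) - 1) + ((x - a) / x - 1) = 0 := by
    have := hq.ne'
    field_simp
    ring
  have t1 := mul_le_mul_of_nonneg_left (log_tangent_le h2 c1) hp0.le
  have t2 := mul_le_mul_of_nonneg_left (log_tangent_le h3 c2) hq.le
  have t3 := log_tangent_le h1 hx
  rw [l1] at t1
  rw [l2] at t2
  refine ⟨by linarith, ?_, ?_⟩
  · intro heq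
    have ha : a = 0 := by
      by_contra hne
      have s3 := log_tangent_lt h1 hx (fun h => hne (by linarith))
      linarith
    refine ⟨ha, ?_⟩
    by_contra hne
    have s1 := mul_lt_mul_of_pos_left
      (log_tangent_lt h2 c1 (fun h => hne (by linarith))) hp0
    rw [l1] at s1
    linarith
  · rintro ⟨rfl, rfl⟩
    have e1 : x + 0 + (2 * p - 1) * x = 2 * p * x := by ring
    have e2 : x + 0 - (2 * p - 1) * x = 2 * (1 - p) * x := by ring
    rw [e1, e2, l1, l2, sub_zero]
    ring
end

section
/- Let x > 0, α ∈ (0,1) and p ∈ (0,1) with p ≠ 1/2. Then there exist a ∈ (−x, x) with a ≠ 0 and b ∈ ℝ with x + a + b > 0 and x + a − b > 0 such that for every b' ∈ (−x, x): (1/2)·[p·(x+a+b)^α + (1−p)·(x+a−b)^α] + (1/2)·(x−a)^α > (1/2)·[p·(x+b')^α + (1−p)·(x−b')^α] + (1/2)·x^α. -/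
lemma exists_better_aux (α A B : ℝ) (hα : 0 < α) (h : A ≠ B) :
    ∃ t ∈ Set.Ioo (-1:ℝ) 1, A + B < A * (1 + t) ^ α + B * (1 - t) ^ α := by
  by_contra! hc
  have hmax : IsLocalMax (fun t : ℝ => A * (1 + t) ^ α + B * (1 - t) ^ α) 0 := by
    have : Set.Ioo (-1:ℝ) 1 ∈ nhds (0:ℝ) := Ioo_mem_nhds (by norm_num) (by norm_num)
    filter_upwards [this] with t ht
    simpa using hc t ht
  have h1 : HasDerivAt (fun t : ℝ => (1 + t) ^ α) (1 * α * (1 + 0) ^ (α - 1)) 0 :=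
    ((hasDerivAt_id (0:ℝ)).const_add 1).rpow_const (Or.inl (by norm_num))
  have h2 : HasDerivAt (fun t : ℝ => (1 - t) ^ α) (-1 * α * (1 - 0) ^ (α - 1)) 0 :=
    ((hasDerivAt_id (0:ℝ)).const_sub 1).rpow_const (Or.inl (by norm_num))
  have h3 := hmax.hasDerivAt_eq_zero ((h1.const_mul A).add (h2.const_mul B))
  simp at h3
  have : α * (A - B) = 0 := by linarith
  rcases mul_eq_zero.1 this with h | h
  · linarith
  · exact absurd (sub_eq_zero.1 h) ‹A ≠ B›

/-- Non-myopia of the power-utility investor (Example 4.4): if `p ≠ 1/2`, some nonzero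
first-period position `a` together with a suitable second-period position `b` strictly
beats every strategy with zero first-period position. -/
theorem power_utility_investor_not_myopic
    (x α p : ℝ) (hx : 0 < x) (hα : α ∈ Set.Ioo (0:ℝ) 1)
    (hp : p ∈ Set.Ioo (0:ℝ) 1) (hp2 : p ≠ 1/2) :
    ∃ a ∈ Set.Ioo (-x) x, a ≠ 0 ∧ ∃ b : ℝ, 0 < x + a + b ∧ 0 < x + a - b ∧
      ∀ b' ∈ Set.Ioo (-x) x,
        (1/2) * (p * (x + b') ^ α + (1 - p) * (x - b') ^ α) + (1/2) * x ^ α <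
          (1/2) * (p * (x + a + b) ^ α + (1 - p) * (x + a - b) ^ α)
            + (1/2) * (x - a) ^ α := by
  obtain ⟨hα0, hα1⟩ := hα
  obtain ⟨hp0, hp1⟩ := hp
  set f : ℝ → ℝ := fun t => p * (1 + t) ^ α + (1 - p) * (1 - t) ^ α with hf
  have hbdd : BddAbove (f '' Set.Ioo (-1:ℝ) 1) := by
    refine ⟨2 ^ α, ?_⟩
    rintro _ ⟨t, ⟨ht1, ht2⟩, rfl⟩
    have e1 : (1 + t) ^ α ≤ 2 ^ α :=
      Real.rpow_le_rpow (by linarith) (by linarith) hα0.le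
    have e2 : (1 - t) ^ α ≤ 2 ^ α :=
      Real.rpow_le_rpow (by linarith) (by linarith) hα0.le
    simp only [hf]
    nlinarith
  set M := sSup (f '' Set.Ioo (-1:ℝ) 1) with hM
  have hle : ∀ t ∈ Set.Ioo (-1:ℝ) 1, f t ≤ M := fun t ht =>
    le_csSup hbdd (Set.mem_image_of_mem f ht)
  have hM1 : 1 < M := by
    obtain ⟨t, ht, h⟩ := exists_better_aux α p (1 - p) hα0
      (fun h => hp2 (by linarith))
    have := hle t ht
    simp only [hf] at this
    linarith
  obtain ⟨s, ⟨hs1, hs2⟩, hs⟩ := exists_better_aux α M 1 hα0 hM1.ne'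
  have hc : 0 < (1 + s) ^ α := Real.rpow_pos_of_pos (by linarith) _
  have hlt : (M + 1 - (1 - s) ^ α) / (1 + s) ^ α < M := by
    rw [div_lt_iff₀ hc]; linarith
  obtain ⟨_, ⟨t, ⟨ht1, ht2⟩, rfl⟩, ht⟩ := exists_lt_of_lt_csSup
    (Set.Nonempty.image f (Set.nonempty_Ioo.2 (by norm_num : (-1:ℝ) < 1))) hlt
  rw [div_lt_iff₀ hc] at ht
  have hxa : 0 < x ^ α := Real.rpow_pos_of_pos hx _
  have q1 : x + x * s + x * (1 + s) * t = x * ((1 + s) * (1 + t)) := by ring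
  have q2 : x + x * s - x * (1 + s) * t = x * ((1 + s) * (1 - t)) := by ring
  have q3 : x - x * s = x * (1 - s) := by ring
  have i1 : 0 < 1 + s := by linarith
  have i2 : 0 < 1 - s := by linarith
  have i3 : 0 < 1 + t := by linarith
  have i4 : 0 < 1 - t := by linarith
  refine ⟨x * s, ⟨by nlinarith, by nlinarith⟩, ?_, x * (1 + s) * t, ?_, ?_, ?_⟩
  · refine mul_ne_zero hx.ne' ?_
    rintro rfl
    simp at hs
  · rw [q1]; positivity
  · rw [q2]; positivity
  · rintro b' ⟨hb1, hb2⟩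
    have hu : b' / x ∈ Set.Ioo (-1:ℝ) 1 :=
      ⟨by rw [lt_div_iff₀ hx]; linarith, by rw [div_lt_iff₀ hx]; linarith⟩
    obtain ⟨u, rfl⟩ : ∃ u, b' = x * u := ⟨b' / x, by field_simp⟩
    rw [mul_div_cancel_left₀ _ hx.ne'] at hu
    have r1 : x + x * u = x * (1 + u) := by ring
    have r2 : x - x * u = x * (1 - u) := by ring
    have j1 : 0 ≤ 1 + u := by linarith [hu.1]
    have j2 : 0 ≤ 1 - u := by linarith [hu.2]
    have hfu := hle u hu
    rw [q1, q2, q3, r1, r2, Real.mul_rpow hx.le j1, Real.mul_rpow hx.le j2,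
      Real.mul_rpow hx.le (by positivity), Real.mul_rpow hx.le (by positivity),
      Real.mul_rpow hx.le i2.le, Real.mul_rpow i1.le i3.le, Real.mul_rpow i1.le i4.le]
    have key : f u + 1 < f t * (1 + s) ^ α + (1 - s) ^ α := by linarith
    have := mul_lt_mul_of_pos_left key hxa
    simp only [hf] at this
    linarith
end
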